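/- arXiv:2305.08927 — 2 statements merged into one kernel-verified Lean document; each statement's English description precedes it below -/
import Mathlib

section
/- Let $\Phi$ and $\Psi$ be slowly varying functions at infinity, locally integrable on $[1,\infty)$, with $\int_1^\infty \Phi(\sigma)\sigma^{-1}d\sigma = \int_1^\infty \Psi(\sigma)\sigma^{-1}d\sigma = \infty$. Then their Mellin convolution $(\Phi*\Psi)(s) = \int_1^s \Phi(\sigma)\Psi(s/\sigma)\sigma^{-1}\,d\sigma$ is slowly varying at infinity. -/
set_option autoImplicit false

open Filter MeasureTheory

/-- A measurable function, positive on some `[A, ∞)`, is slowly varying at infinity if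
`f (ρ x) / f x → 1` as `x → ∞` for every `ρ > 0`. -/
def SlowlyVarying (f : ℝ → ℝ) : Prop :=
  Measurable f ∧ (∃ A : ℝ, ∀ x, A ≤ x → 0 < f x) ∧
  ∀ ρ : ℝ, 0 < ρ → Tendsto (fun x => f (ρ * x) / f x) atTop (nhds 1)

/-- A measurable function on `ℝ` whose additive increments tend to `0` at `+∞` has increments
tending to `0` uniformly over bounded shifts. -/
theorem eventually_forall_abs_add_sub_lt {k : ℝ → ℝ} (hk : Measurable k)
    (h : ∀ u, Tendsto (fun x => k (x + u) - k x) atTop (nhds 0)) (A : ℝ) {ε : ℝ} (hε : 0 < ε) :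
    ∀ᶠ x in atTop, ∀ u, |u| ≤ A → |k (x + u) - k x| < ε := by
  have hvol : ∀ a b : ℝ, ∀ᶠ x in atTop,
      volume {v ∈ Set.Icc a b | ε / 2 ≤ |k (x + v) - k x|} < ENNReal.ofReal (1 / 2) := by
    intro a b
    have ht : Tendsto (fun x : ℝ => volume {v ∈ Set.Icc a b | ε / 2 ≤ |k (x + v) - k x|}) atTop
        (nhds (volume (∅ : Set ℝ))) := by
      refine tendsto_measure_of_tendsto_indicator atTop (fun x => ?_) (B := Set.Icc a b)
        measurableSet_Icc (by simp) (Eventually.of_forall fun x v hv => hv.1) ?_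
      · have hm : Measurable fun v => |k (x + v) - k x| := by fun_prop
        exact measurableSet_Icc.inter (measurableSet_le measurable_const hm)
      · intro v
        filter_upwards [(h v).eventually (Metric.ball_mem_nhds 0 (half_pos hε))] with x hx
        simp only [dist_zero_right, Real.norm_eq_abs] at hx
        simp [hx]
    rw [measure_empty] at ht
    exact ht.eventually_lt_const (by simp)
  have h1 := hvol 0 1
  have h2 := eventually_forall_ge_atTop.2 (hvol (-A) (A + 1))
  have h2' := (tendsto_atTop_add_const_right atTop (-A) tendsto_id).eventually h2
  filter_upwards [h1, h2'] with x hx hy u hu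
  simp only [id] at hy
  obtain ⟨hu1, hu2⟩ := abs_le.1 hu
  have hy' := hy (x + u) (by linarith)
  set V := {v ∈ Set.Icc (0 : ℝ) 1 | ε / 2 ≤ |k (x + v) - k x|} with hV
  set W := {v ∈ Set.Icc (-A) (A + 1) | ε / 2 ≤ |k (x + u + v) - k (x + u)|} with hW
  have hW' : volume ((fun v => v + -u) ⁻¹' W) = volume W := measure_preimage_add_right _ _ _
  obtain ⟨v, hv, hvn⟩ : ∃ v ∈ Set.Icc (0 : ℝ) 1, v ∉ V ∪ (fun v => v + -u) ⁻¹' W := by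
    by_contra! hcon
    have h3 : volume (Set.Icc (0 : ℝ) 1) ≤ volume V + volume ((fun v => v + -u) ⁻¹' W) :=
      (measure_mono hcon).trans (measure_union_le _ _)
    have h4 : volume V + volume ((fun v => v + -u) ⁻¹' W) <
        ENNReal.ofReal (1 / 2) + ENNReal.ofReal (1 / 2) := by
      rw [hW']; exact ENNReal.add_lt_add hx hy'
    rw [← ENNReal.ofReal_add (by norm_num) (by norm_num)] at h4
    norm_num at h3 h4
    exact absurd h3 (not_le.2 h4)
  simp only [Set.mem_union, not_or, hV, hW, Set.mem_preimage, Set.mem_ofPred_eq, not_and,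
    not_le] at hvn
  have a1 := hvn.1 hv
  have a2 := hvn.2 ⟨by linarith [hv.1], by linarith [hv.2]⟩
  rw [show x + u + (v + -u) = x + v by ring] at a2
  rw [abs_lt] at a1 a2 ⊢
  constructor <;> linarith

/-- The additive counterpart of slow variation at infinity, with integrability on compact
subintervals of `[0, ∞)`. -/
structure AddSlowlyVarying (f : ℝ → ℝ) : Prop where
  measurable : Measurable f
  pos : ∀ᶠ x in atTop, 0 < f x
  tendsto : ∀ c, Tendsto (fun x => f (x + c) / f x) atTop (nhds 1)
  integrable : ∀ a b, 0 ≤ a → 0 ≤ b → IntervalIntegrable f volume a b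

namespace AddSlowlyVarying

variable {f g : ℝ → ℝ}

/-- The uniform convergence theorem for slowly varying functions. -/
theorem uniform (hf : AddSlowlyVarying f) (A : ℝ) {ε : ℝ} (hε : 0 < ε) :
    ∀ᶠ x in atTop, ∀ u, |u| ≤ A → |f (x + u) - f x| ≤ ε * f x := by
  have hlog : ∀ u, Tendsto (fun x => Real.log (f (x + u)) - Real.log (f x)) atTop (nhds 0) := by
    intro u
    have h := (hf.tendsto u).log one_ne_zero
    rw [Real.log_one] at h
    refine h.congr' ?_
    filter_upwards [hf.pos, (tendsto_atTop_add_const_right atTop u tendsto_id).eventually hf.pos]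
      with x h1 h2
    exact Real.log_div h2.ne' h1.ne'
  have hδ : 0 < min 1 (ε / 2) := by positivity
  have hp := (tendsto_atTop_add_const_right atTop (-A) tendsto_id).eventually
    (eventually_forall_ge_atTop.2 hf.pos)
  filter_upwards [eventually_forall_abs_add_sub_lt (hf.measurable.log) hlog A hδ, hp, hf.pos]
    with x hx hp h0 u hu
  have hu' := hp (x + u) (by simp only [id]; linarith [(abs_le.1 hu).1])
  have h1 := hx u hu
  have h2 := Real.abs_exp_sub_one_le (h1.le.trans (min_le_left _ _))
  rw [Real.exp_sub, Real.exp_log hu', Real.exp_log h0] at h2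
  have h3 : |f (x + u) / f x - 1| ≤ ε := by
    linarith [h1.le.trans (min_le_right _ _)]
  have h4 : f (x + u) - f x = (f (x + u) / f x - 1) * f x := by field_simp
  rw [h4, abs_mul, abs_of_pos h0]
  gcongr

theorem bounded (hf : AddSlowlyVarying f) :
    ∃ X, 0 ≤ X ∧ ∀ Y, ∃ K, ∀ x ∈ Set.Icc X Y, |f x| ≤ K := by
  obtain ⟨X, hX⟩ := eventually_atTop.1
    ((hf.uniform 1 one_pos).and (hf.pos.and (eventually_ge_atTop 0)))
  refine ⟨X, (hX X le_rfl).2.2, ?_⟩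
  have key : ∀ n : ℕ, ∀ x ∈ Set.Icc X (X + n), |f x| ≤ 2 ^ n * f X := by
    intro n
    induction n with
    | zero =>
      intro x hx
      have : x = X := le_antisymm (by simpa using hx.2) hx.1
      simp [this, abs_of_pos (hX X le_rfl).2.1]
    | succ n ih =>
      intro x hx
      have hx2 := hx.2
      push_cast at hx2
      obtain ⟨u, hu0, hu1, hu2⟩ : ∃ u, 0 ≤ u ∧ u ≤ 1 ∧ x - u ∈ Set.Icc X (X + n) := by
        by_cases h : X + 1 ≤ x
        · exact ⟨1, zero_le_one, le_rfl, by linarith, by linarith⟩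
        · refine ⟨x - X, by linarith [hx.1], by linarith, by simp⟩
      have h1 := ih _ hu2
      have h2 := (hX _ hu2.1).1 u (by rwa [abs_of_nonneg hu0])
      have h3 := (hX _ hu2.1).2.1
      have h4 := (hX _ hx.1).2.1
      rw [sub_add_cancel] at h2
      rw [abs_of_pos h3] at h1
      rw [abs_of_pos h4, pow_succ]
      linarith [(abs_le.1 h2).2]
  intro Y
  obtain ⟨n, hn⟩ := exists_nat_ge (Y - X)
  exact ⟨_, fun x hx => key n x ⟨hx.1, by linarith [hx.2]⟩⟩

theorem mul_comp_sub_half (hf : AddSlowlyVarying f) (hg : AddSlowlyVarying g) :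
    ∀ᶠ x in atTop, IntervalIntegrable (fun t => f t * g (x - t)) volume 0 (x / 2) := by
  obtain ⟨X, hX0, hX⟩ := hg.bounded
  filter_upwards [eventually_ge_atTop (2 * X)] with x hx
  have hx0 : 0 ≤ x / 2 := by linarith
  obtain ⟨K, hK⟩ := hX x
  have hi := hf.integrable 0 (x / 2) le_rfl hx0
  rw [intervalIntegrable_iff_integrableOn_Ioc_of_le hx0] at hi ⊢
  refine Integrable.mul_bdd (c := K) hi
    (hg.measurable.comp (measurable_const.sub measurable_id)).aestronglyMeasurable ?_
  refine (ae_restrict_iff' measurableSet_Ioc).2 (Eventually.of_forall fun t ht => ?_)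
  exact hK _ ⟨by linarith [ht.2], by linarith [ht.1]⟩

theorem mul_comp_sub (hf : AddSlowlyVarying f) (hg : AddSlowlyVarying g) :
    ∀ᶠ x in atTop, ∀ a b, 0 ≤ a → a ≤ x → 0 ≤ b → b ≤ x →
      IntervalIntegrable (fun t => f t * g (x - t)) volume a b := by
  filter_upwards [hf.mul_comp_sub_half hg, hg.mul_comp_sub_half hf, eventually_ge_atTop 0]
    with x h1 h2 hx a b ha hax hb hbx
  have h3 := h2.comp_sub_left x
  rw [sub_zero, sub_half] at h3
  simp only [sub_sub_cancel, mul_comm (g _)] at h3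
  refine (h1.trans h3.symm).mono_set ?_
  rw [Set.uIcc_of_le hx]
  exact Set.uIcc_subset_Icc ⟨ha, hax⟩ ⟨hb, hbx⟩

theorem edge_bound (hf : AddSlowlyVarying f) (hg : AddSlowlyVarying g) {A : ℝ} (hA : 0 ≤ A)
    (c : ℝ) : ∃ C, 0 ≤ C ∧ ∀ᶠ x in atTop,
      |∫ t in 0..A, f t * g (x + c - t)| ≤ C * g x := by
  refine ⟨∫ t in 0..A, |f t| * 2,
    intervalIntegral.integral_nonneg hA fun t _ => by positivity, ?_⟩
  filter_upwards [hg.uniform (A + |c|) one_pos] with x hx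
  rw [← intervalIntegral.integral_mul_const, ← Real.norm_eq_abs]
  refine intervalIntegral.norm_integral_le_of_norm_le hA
    (Eventually.of_forall fun t ht => ?_)
    ((((hf.integrable 0 A le_rfl hA).abs).mul_const _).mul_const _)
  have h1 := hx (c - t) (by
    have := abs_sub c t
    rw [abs_of_pos ht.1] at this
    linarith [ht.2])
  rw [show x + (c - t) = x + c - t by ring] at h1
  rw [Real.norm_eq_abs, abs_mul, mul_assoc]
  gcongr
  have h2 := abs_le.1 h1
  exact abs_le.2 ⟨by linarith, by linarith⟩

theorem abs_integral_sub_middle_le (hf : AddSlowlyVarying f) (hg : AddSlowlyVarying g) {A c : ℝ}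
    (hA : 0 ≤ A) (hAc : 0 ≤ A + c) : ∃ C, 0 ≤ C ∧ ∀ᶠ x in atTop,
      |(∫ t in 0..(x + c), f t * g (x + c - t)) - ∫ t in A..(x - A), f t * g (x + c - t)| ≤
        C * (f x + g x) := by
  obtain ⟨C₁, hC₁, h1⟩ := hf.edge_bound hg hA c
  obtain ⟨C₂, hC₂, h2⟩ := hg.edge_bound hf hAc c
  refine ⟨C₁ + C₂, by positivity, ?_⟩
  filter_upwards [h1, h2, hf.pos, hg.pos, eventually_ge_atTop (2 * A),
    (tendsto_atTop_add_const_right atTop c tendsto_id).eventually (hf.mul_comp_sub hg)]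
    with x h1 h2 hf0 hg0 hx hi
  simp only [id] at hi
  have i1 := hi 0 A le_rfl (by linarith) hA (by linarith)
  have i2 := hi A (x - A) hA (by linarith) (by linarith) (by linarith)
  have i3 := hi (x - A) (x + c) (by linarith) (by linarith) (by linarith) le_rfl
  rw [← intervalIntegral.integral_add_adjacent_intervals (i1.trans i2) i3,
    ← intervalIntegral.integral_add_adjacent_intervals i1 i2]
  have e := intervalIntegral.integral_comp_sub_left (a := 0) (b := A + c)
    (fun t => f t * g (x + c - t)) (x + c)
  simp only [sub_sub_cancel, sub_zero, mul_comm (f _)] at e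
  rw [show x + c - (A + c) = x - A by ring] at e
  rw [e] at h2
  simp only [mul_comm (g _)] at h2
  rw [abs_le] at h1 h2 ⊢
  have := mul_nonneg hC₁ hf0.le
  have := mul_nonneg hC₂ hg0.le
  constructor <;> nlinarith

theorem eventually_le_integral (hf : AddSlowlyVarying f) (hf' : ¬ IntegrableOn f (Set.Ici 0))
    {A : ℝ} (hA : 0 ≤ A) (hpos : ∀ x, A ≤ x → 0 < f x) (K : ℝ) :
    ∀ᶠ B in atTop, K ≤ ∫ t in A..B, f t := by
  obtain ⟨B₀, hB₀, hAB⟩ : ∃ B₀, A ≤ B₀ ∧ K ≤ ∫ t in A..B₀, f t := by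
    by_contra! hcon
    apply hf'
    rw [integrableOn_Ici_iff_integrableOn_Ioi, ← Set.Ioc_union_Ioi_eq_Ioi hA]
    refine ((intervalIntegrable_iff_integrableOn_Ioc_of_le hA).1
      (hf.integrable 0 A le_rfl hA)).union ?_
    refine integrableOn_Ioi_of_intervalIntegral_norm_bounded (l := atTop)
      (b := fun r : ℝ => max A r) K A (fun r => ?_)
      (tendsto_atTop_mono (le_max_right A) tendsto_id) (Eventually.of_forall fun r => ?_)
    · exact (intervalIntegrable_iff_integrableOn_Ioc_of_le (le_max_left _ _)).1
        (hf.integrable _ _ hA (hA.trans (le_max_left _ _)))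
    · refine le_trans (le_of_eq ?_) (hcon _ (le_max_left A r)).le
      refine intervalIntegral.integral_congr fun t ht => ?_
      rw [Set.uIcc_of_le (le_max_left _ _)] at ht
      simp only [Real.norm_eq_abs, abs_of_pos (hpos t ht.1)]
  filter_upwards [eventually_ge_atTop B₀] with B hB
  rw [← intervalIntegral.integral_add_adjacent_intervals (hf.integrable A B₀ hA (hA.trans hB₀))
    (hf.integrable B₀ B (hA.trans hB₀) ((hA.trans hB₀).trans hB))]
  have := intervalIntegral.integral_nonneg (μ := volume) hB
    fun t ht => (hpos t (hB₀.trans ht.1)).le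
  linarith

theorem le_edge (hf : AddSlowlyVarying f) (hg : AddSlowlyVarying g) {A B : ℝ} (hA : 0 ≤ A)
    (hAB : A ≤ B) (hpos : ∀ x, A ≤ x → 0 < f x) :
    ∀ᶠ x in atTop, (∫ t in A..B, f t) * (1 / 2 * g x) ≤ ∫ t in A..B, f t * g (x - t) := by
  filter_upwards [hg.uniform B (ε := 1 / 2) (by norm_num), hf.mul_comp_sub hg,
    eventually_ge_atTop B] with x hx hi hBx
  rw [← intervalIntegral.integral_mul_const]
  have hB := hA.trans hAB
  refine intervalIntegral.integral_mono_on hAB ((hf.integrable A B hA hB).mul_const _)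
    (hi A B hA (hAB.trans hBx) hB hBx) fun t ht => ?_
  have h := hx (-t) (by rw [abs_neg, abs_of_nonneg (hA.trans ht.1)]; exact ht.2)
  rw [← sub_eq_add_neg, abs_le] at h
  have := (hpos t ht.1).le
  gcongr
  linarith [h.1]

/-- The convolution dominates every multiple of the sum of its factors. -/
theorem mul_add_le_integral (hf : AddSlowlyVarying f) (hg : AddSlowlyVarying g)
    (hf' : ¬ IntegrableOn f (Set.Ici 0)) (hg' : ¬ IntegrableOn g (Set.Ici 0)) (K : ℝ) :
    ∀ᶠ x in atTop, K * (f x + g x) ≤ ∫ t in 0..x, f t * g (x - t) := by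
  obtain ⟨A, hA⟩ := eventually_atTop.1 ((hf.pos.and hg.pos).and (eventually_ge_atTop 0))
  have hA0 : 0 ≤ A := (hA A le_rfl).2
  have hfA : ∀ x, A ≤ x → 0 < f x := fun x hx => (hA x hx).1.1
  have hgA : ∀ x, A ≤ x → 0 < g x := fun x hx => (hA x hx).1.2
  obtain ⟨C, hC, hmid⟩ := hf.abs_integral_sub_middle_le hg (c := 0) hA0 (by linarith)
  obtain ⟨B, ⟨hB1, hB2⟩, hAB⟩ := (((hf.eventually_le_integral hf' hA0 hfA (2 * (K + C))).and
    (hg.eventually_le_integral hg' hA0 hgA (2 * (K + C)))).and (eventually_ge_atTop A)).exists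
  filter_upwards [hmid, hf.le_edge hg hA0 hAB hfA, hg.le_edge hf hA0 hAB hgA,
    hf.mul_comp_sub hg, eventually_ge_atTop (2 * B)] with x hmid h1 h2 hi hx
  simp only [add_zero] at hmid
  have hfx := hfA x (by linarith)
  have hgx := hgA x (by linarith)
  have i1 := hi A B hA0 (by linarith) (by linarith) (by linarith)
  have i2 := hi B (x - B) (by linarith) (by linarith) (by linarith) (by linarith)
  have i3 := hi (x - B) (x - A) (by linarith) (by linarith) (by linarith) (by linarith)
  rw [← intervalIntegral.integral_add_adjacent_intervals (i1.trans i2) i3,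
    ← intervalIntegral.integral_add_adjacent_intervals i1 i2] at hmid
  have e := intervalIntegral.integral_comp_sub_left (a := A) (b := B)
    (fun t => f t * g (x - t)) x
  simp only [sub_sub_cancel, mul_comm (f _)] at e
  rw [e] at h2
  simp only [mul_comm (g _)] at h2
  have h3 : 0 ≤ ∫ t in B..(x - B), f t * g (x - t) :=
    intervalIntegral.integral_nonneg (by linarith) fun t ht =>
      (mul_pos (hfA t (by linarith [ht.1])) (hgA _ (by linarith [ht.2]))).le
  have h4 : 2 * (K + C) * (1 / 2 * g x) ≤ (∫ t in A..B, f t) * (1 / 2 * g x) := by gcongr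
  have h5 : 2 * (K + C) * (1 / 2 * f x) ≤ (∫ t in A..B, g t) * (1 / 2 * f x) := by gcongr
  have := (abs_le.1 hmid).1
  linarith

theorem tendsto_integral_div (hf : AddSlowlyVarying f) (hg : AddSlowlyVarying g)
    (hf' : ¬ IntegrableOn f (Set.Ici 0)) (hg' : ¬ IntegrableOn g (Set.Ici 0)) (c : ℝ) :
    Tendsto (fun x => (∫ t in 0..(x + c), f t * g (x + c - t)) / ∫ t in 0..x, f t * g (x - t))
      atTop (nhds 1) := by
  rw [Metric.tendsto_nhds]
  intro δ hδ
  obtain ⟨ε, hε, hεδ⟩ := exists_between hδ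
  obtain ⟨A, hA⟩ := eventually_atTop.1 ((((hf.pos.and hg.pos).and
    (hg.uniform |c| (half_pos hε))).and (eventually_ge_atTop 0)).and (eventually_ge_atTop |c|))
  have hA0 : 0 ≤ A := (hA A le_rfl).1.2
  have hAc : 0 ≤ A + c := by linarith [(hA A le_rfl).2, neg_abs_le c]
  obtain ⟨C₁, hC₁, h1⟩ := hf.abs_integral_sub_middle_le hg hA0 hAc
  obtain ⟨C₂, hC₂, h2⟩ := hf.abs_integral_sub_middle_le hg (c := 0) hA0 (by linarith)
  filter_upwards [h1, h2, hf.mul_add_le_integral hg hf' hg' 1,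
    hf.mul_add_le_integral hg hf' hg' ((C₁ + C₂ + ε / 2 * C₂) / (ε / 2)),
    hf.mul_comp_sub hg, eventually_ge_atTop (2 * A), hf.pos, hg.pos,
    (tendsto_atTop_add_const_right atTop c tendsto_id).eventually (hf.mul_comp_sub hg)]
    with x h1 h2 h3 h4 hi hx hfx hgx hic
  simp only [add_zero, id] at h2 hic
  have i := hi A (x - A) hA0 (by linarith) (by linarith) (by linarith)
  have ic := hic A (x - A) hA0 (by linarith) (by linarith) (by linarith)
  have h5 : |(∫ t in A..(x - A), f t * g (x + c - t)) - ∫ t in A..(x - A), f t * g (x - t)| ≤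
      ε / 2 * ∫ t in A..(x - A), f t * g (x - t) := by
    rw [← intervalIntegral.integral_sub ic i, ← intervalIntegral.integral_const_mul,
      ← Real.norm_eq_abs]
    refine intervalIntegral.norm_integral_le_of_norm_le (by linarith)
      (Eventually.of_forall fun t ht => ?_) (i.const_mul _)
    have := (hA (x - t) (by linarith [ht.2])).1.1.2 c le_rfl
    rw [← mul_sub, Real.norm_eq_abs, abs_mul, abs_of_pos (hA t ht.1.le).1.1.1.1,
      mul_left_comm, show x + c - t = x - t + c by ring]
    gcongr
    exact (hA t ht.1.le).1.1.1.1.le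
  set H := ∫ t in 0..x, f t * g (x - t)
  have hH : 0 < H := by linarith
  rw [div_mul_eq_mul_div, div_le_iff₀ (half_pos hε)] at h4
  rw [Real.dist_eq, div_sub_one hH.ne', abs_div, abs_of_pos hH, div_lt_iff₀ hH]
  refine lt_of_le_of_lt ?_ (mul_lt_mul_of_pos_right hεδ hH)
  have h6 := mul_le_mul_of_nonneg_left (abs_le.1 h2).1 (half_pos hε).le
  rw [abs_le] at h1 h2 h5 ⊢
  constructor <;> linarith

end AddSlowlyVarying

theorem setIntegral_Ioc_one_eq_intervalIntegral_exp (F : ℝ → ℝ) {s : ℝ} (hs : 1 ≤ s) :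
    ∫ σ in Set.Ioc 1 s, F σ / σ = ∫ t in 0..Real.log s, F (Real.exp t) := by
  have hs0 : 0 < s := by linarith
  have him : Set.Ioc 1 s = Real.exp '' Set.Ioc 0 (Real.log s) := by
    rw [Real.image_exp_Ioc, Real.exp_zero, Real.exp_log hs0]
  rw [him, integral_image_eq_integral_abs_deriv_smul measurableSet_Ioc
    (fun x _ => (Real.hasDerivAt_exp x).hasDerivWithinAt) Real.exp_injective.injOn,
    intervalIntegral.integral_of_le (Real.log_nonneg hs)]
  refine integral_congr_ae (Eventually.of_forall fun t => ?_)
  simp only [abs_of_pos (Real.exp_pos t), smul_eq_mul]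
  field_simp

theorem integrableOn_exp_image_iff (F : ℝ → ℝ) {S : Set ℝ} (hS : MeasurableSet S) :
    IntegrableOn (fun σ => F σ / σ) (Real.exp '' S) ↔ IntegrableOn (fun t => F (Real.exp t)) S := by
  rw [integrableOn_image_iff_integrableOn_abs_deriv_smul hS
    (fun x _ => (Real.hasDerivAt_exp x).hasDerivWithinAt) Real.exp_injective.injOn]
  refine integrableOn_congr_fun (fun t _ => ?_) hS
  simp only [abs_of_pos (Real.exp_pos t), smul_eq_mul]
  field_simp

theorem SlowlyVarying.comp_exp {Φ : ℝ → ℝ} (hΦ : SlowlyVarying Φ)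
    (hloc : LocallyIntegrableOn Φ (Set.Ici 1)) :
    AddSlowlyVarying fun t => Φ (Real.exp t) := by
  obtain ⟨hm, ⟨A, hA⟩, hr⟩ := hΦ
  refine ⟨hm.comp Real.measurable_exp,
    (Real.tendsto_exp_atTop.eventually_ge_atTop A).mono fun x hx => hA _ hx, fun c => ?_,
    fun a b ha hb => ?_⟩
  · refine ((hr (Real.exp c) (Real.exp_pos c)).comp Real.tendsto_exp_atTop).congr fun x => ?_
    simp only [Function.comp, Real.exp_add, mul_comm]
  · rw [intervalIntegrable_iff, Set.uIoc, ← integrableOn_exp_image_iff _ measurableSet_Ioc,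
      Real.image_exp_Ioc]
    have h1 : 1 ≤ Real.exp (min a b) := Real.one_le_exp (le_min ha hb)
    have hc := hloc.integrableOn_compact_subset
      (t := Set.Icc (Real.exp (min a b)) (Real.exp (max a b)))
      (fun x hx => h1.trans hx.1) isCompact_Icc
    have := hc.mul_continuousOn (g' := fun σ => σ⁻¹)
      (continuousOn_id.inv₀ fun x hx => by
        have := hx.1
        simp only [id]
        linarith) isCompact_Icc
    exact this.mono_set Set.Ioc_subset_Icc_self

theorem not_integrableOn_comp_exp {Φ : ℝ → ℝ}
    (hdiv : ¬ IntegrableOn (fun σ => Φ σ / σ) (Set.Ici 1)) :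
    ¬ IntegrableOn (fun t => Φ (Real.exp t)) (Set.Ici 0) := by
  rw [integrableOn_Ici_iff_integrableOn_Ioi] at hdiv ⊢
  have him : Real.exp '' Set.Ioi 0 = Set.Ioi 1 := by
    ext y
    constructor
    · rintro ⟨x, hx, rfl⟩
      exact Real.one_lt_exp_iff.2 hx
    · intro hy
      have hy' : (1 : ℝ) < y := hy
      exact ⟨Real.log y, Real.log_pos hy', Real.exp_log (by linarith)⟩
  rwa [← integrableOn_exp_image_iff _ measurableSet_Ioi, him]

theorem measurable_mellinConvolution {Φ Ψ : ℝ → ℝ} (hΦ : Measurable Φ) (hΨ : Measurable Ψ) :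
    Measurable fun s => ∫ σ in Set.Ioc 1 s, Φ σ * Ψ (s / σ) / σ := by
  simp_rw [← integral_indicator (measurableSet_Ioc (a := (1 : ℝ)))]
  refine (StronglyMeasurable.integral_prod_right (Measurable.stronglyMeasurable ?_)).measurable
  have hS : MeasurableSet {p : ℝ × ℝ | 1 < p.2 ∧ p.2 ≤ p.1} :=
    (measurableSet_lt measurable_const measurable_snd).inter
      (measurableSet_le measurable_snd measurable_fst)
  have hF : Measurable fun p : ℝ × ℝ => Φ p.2 * Ψ (p.1 / p.2) / p.2 := by fun_prop
  exact hF.indicator hS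

/-- The Mellin convolution `(Φ * Ψ)(s) = ∫_1^s Φ(σ) Ψ(s/σ) σ⁻¹ dσ` of two slowly varying
functions with divergent logarithmic integrals is slowly varying at infinity. -/
theorem slowlyVarying_mellinConvolution (Φ Ψ : ℝ → ℝ)
    (hΦ : SlowlyVarying Φ) (hΨ : SlowlyVarying Ψ)
    (hΦloc : LocallyIntegrableOn Φ (Set.Ici 1))
    (hΨloc : LocallyIntegrableOn Ψ (Set.Ici 1))
    (hΦdiv : ¬ IntegrableOn (fun σ => Φ σ / σ) (Set.Ici 1))
    (hΨdiv : ¬ IntegrableOn (fun σ => Ψ σ / σ) (Set.Ici 1)) :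
    SlowlyVarying (fun s => ∫ σ in Set.Ioc 1 s, Φ σ * Ψ (s / σ) / σ) := by
  have hf := hΦ.comp_exp hΦloc
  have hg := hΨ.comp_exp hΨloc
  have hf' := not_integrableOn_comp_exp hΦdiv
  have hg' := not_integrableOn_comp_exp hΨdiv
  have key : ∀ s : ℝ, 1 ≤ s → ∫ σ in Set.Ioc 1 s, Φ σ * Ψ (s / σ) / σ =
      ∫ t in 0..Real.log s, Φ (Real.exp t) * Ψ (Real.exp (Real.log s - t)) := by
    intro s hs
    simp_rw [Real.exp_sub, Real.exp_log (zero_lt_one.trans_le hs)]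
    exact setIntegral_Ioc_one_eq_intervalIntegral_exp (fun σ => Φ σ * Ψ (s / σ)) hs
  refine ⟨measurable_mellinConvolution hΦ.1 hΨ.1, ?_, fun ρ hρ => ?_⟩
  · refine eventually_atTop.1 ?_
    filter_upwards [Real.tendsto_log_atTop.eventually
      (hf.mul_add_le_integral hg hf' hg' 1), Real.tendsto_log_atTop.eventually hf.pos,
      Real.tendsto_log_atTop.eventually hg.pos, eventually_ge_atTop 1] with s h1 h2 h3 hs
    rw [key s hs]
    linarith
  · refine ((hf.tendsto_integral_div hg hf' hg' (Real.log ρ)).comp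
      Real.tendsto_log_atTop).congr' ?_
    filter_upwards [eventually_ge_atTop 1,
      (tendsto_id.const_mul_atTop hρ).eventually_ge_atTop 1] with s hs hρs
    rw [key s hs, key (ρ * s) hρs, Real.log_mul hρ.ne' (by linarith), add_comm (Real.log ρ)]
    rfl
end

section
/- With the notation of the previous statement, the perturbed processes satisfy the distributional equality $X_{\varphi,\alpha} \stackrel{d}{=} X_{\varphi,\,2/q - \alpha}$ for every $\alpha\in\mathbb R$. -/
set_option autoImplicit false

open MeasureTheory ProbabilityTheory Set Bornology

/-- A real function whose image measure is a centered Gaussian is square integrable,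
with second moment the variance of that Gaussian. -/
lemma memLp_and_integral_sq_of_map_eq_gaussianReal {Ω : Type*} [MeasurableSpace Ω]
    {P : Measure Ω} {f : Ω → ℝ} {v : NNReal} (hf : Measure.map f P = gaussianReal 0 v) :
    MemLp f 2 P ∧ ∫ ω, f ω ^ 2 ∂P = v := by
  have hfm : AEMeasurable f P := by
    refine AEMeasurable.of_map_ne_zero ?_
    rw [hf]
    exact IsProbabilityMeasure.ne_zero _
  constructor
  · have h : MemLp id 2 (Measure.map f P) := by
      rw [hf]
      exact memLp_id_gaussianReal' 2 (by simp)
    exact h.comp_of_map hfm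
  · rw [← variance_fun_id_gaussianReal (μ := 0) (v := v),
      variance_of_integral_eq_zero (by fun_prop) (by simp), ← hf,
      integral_map hfm (by fun_prop)]

/-- **Cramér–Wold**: the law of a random vector is determined by the laws of its linear
combinations. -/
lemma map_eq_of_map_linear_combination_eq {Ω ι : Type*} [MeasurableSpace Ω] [Fintype ι]
    {P : Measure Ω} [IsFiniteMeasure P] {Y Z : Ω → ι → ℝ}
    (hY : AEMeasurable Y P) (hZ : AEMeasurable Z P)
    (h : ∀ c : ι → ℝ, Measure.map (fun ω => ∑ i, c i * Y ω i) P
      = Measure.map (fun ω => ∑ i, c i * Z ω i) P) :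
    Measure.map Y P = Measure.map Z P := by
  classical
  refine Measure.ext_of_charFunDual (funext fun L => ?_)
  have hL (y : ι → ℝ) : L y = ∑ i, L (fun j => if i = j then 1 else 0) * y i := by
    simpa [mul_comm] using LinearMap.pi_apply_eq_sum_univ (L : (ι → ℝ) →ₗ[ℝ] ℝ) y
  rw [charFunDual_eq_charFun_map_one, charFunDual_eq_charFun_map_one,
    AEMeasurable.map_map_of_aemeasurable (by fun_prop) hY,
    AEMeasurable.map_map_of_aemeasurable (by fun_prop) hZ]
  congr 1
  have hcomp (W : Ω → ι → ℝ) :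
      L ∘ W = fun ω => ∑ i, L (fun j => if i = j then 1 else 0) * W ω i :=
    funext fun ω => hL (W ω)
  rw [hcomp Y, hcomp Z]
  exact h _

/-- If `(Z, I)` is a centered Gaussian vector with `E[Z i * I] = ψ i` and `E[I²] = q ≠ 0`, then
`Z - α I ψ` and `Z - (2/q - α) I ψ` have the same law. -/
lemma map_sub_mul_eq_of_gaussian {Ω ι : Type*} [MeasurableSpace Ω] [Fintype ι]
    {P : Measure Ω} [IsFiniteMeasure P] {Z : ι → Ω → ℝ} {I : Ω → ℝ} {ψ : ι → ℝ} {q : ℝ}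
    (hGauss : ∀ (c : ι → ℝ) (c₀ : ℝ), ∃ v : NNReal,
      Measure.map (fun ω => (∑ i, c i * Z i ω) + c₀ * I ω) P = gaussianReal 0 v)
    (hψ : ∀ i, ∫ ω, Z i ω * I ω ∂P = ψ i) (hq : ∫ ω, I ω ^ 2 ∂P = q) (hq0 : q ≠ 0) (α : ℝ) :
    Measure.map (fun ω i => Z i ω - α * ψ i * I ω) P
      = Measure.map (fun ω i => Z i ω - (2 / q - α) * ψ i * I ω) P := by
  classical
  have hI : MemLp I 2 P := by
    obtain ⟨v, hv⟩ := hGauss 0 1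
    simpa using (memLp_and_integral_sq_of_map_eq_gaussianReal hv).1
  have hZ (i : ι) : MemLp (Z i) 2 P := by
    obtain ⟨v, hv⟩ := hGauss (Pi.single i 1) 0
    simpa [Pi.single_apply] using (memLp_and_integral_sq_of_map_eq_gaussianReal hv).1
  have hmeas (β : ℝ) : AEMeasurable (fun ω i => Z i ω - β * ψ i * I ω) P :=
    aemeasurable_pi_lambda _ fun i =>
      (hZ i).aestronglyMeasurable.aemeasurable.sub
        (hI.aestronglyMeasurable.aemeasurable.const_mul _)
  refine map_eq_of_map_linear_combination_eq (hmeas _) (hmeas _) fun c => ?_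
  set A : Ω → ℝ := fun ω => ∑ i, c i * Z i ω with hA
  set B : ℝ := ∑ i, c i * ψ i with hB
  have hcomb (β : ℝ) :
      (fun ω => ∑ i, c i * (Z i ω - β * ψ i * I ω)) = fun ω => A ω + (-(β * B)) * I ω := by
    ext ω
    simp only [hA, hB, mul_sub, Finset.sum_sub_distrib, Finset.mul_sum, neg_mul, Finset.sum_mul,
      ← sub_eq_add_neg]
    congr 1
    exact Finset.sum_congr rfl fun i _ => by ring
  have hAL : MemLp A 2 P := memLp_finsetSum _ fun i _ => (hZ i).const_mul (c i)
  have hZI (i : ι) : Integrable (fun ω => c i * (Z i ω * I ω)) P :=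
    ((hZ i).integrable_mul hI).const_mul (c i)
  have hAI : ∫ ω, A ω * I ω ∂P = B := by
    simp only [hA, hB, Finset.sum_mul, mul_assoc]
    rw [integral_finsetSum _ fun i _ => hZI i]
    simp only [integral_const_mul, hψ]
  have hsq (s : ℝ) :
      ∫ ω, (A ω + s * I ω) ^ 2 ∂P = ∫ ω, A ω ^ 2 ∂P + (2 * s * B + s ^ 2 * q) := by
    have hexp : (fun ω => (A ω + s * I ω) ^ 2)
        = fun ω => A ω ^ 2 + (2 * s * (A ω * I ω) + s ^ 2 * I ω ^ 2) := by
      ext ω; ring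
    have h1 : Integrable (fun ω => 2 * s * (A ω * I ω)) P := (hAL.integrable_mul hI).const_mul _
    have h2 : Integrable (fun ω => s ^ 2 * I ω ^ 2) P := hI.integrable_sq.const_mul _
    have h12 : Integrable (fun ω => 2 * s * (A ω * I ω) + s ^ 2 * I ω ^ 2) P := h1.add h2
    rw [hexp, integral_add hAL.integrable_sq h12, integral_add h1 h2,
      integral_const_mul, integral_const_mul, hAI, hq]
  rw [hcomb, hcomb]
  obtain ⟨v, hv⟩ := hGauss c (-(α * B))
  obtain ⟨w, hw⟩ := hGauss c (-((2 / q - α) * B))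
  have hv2 := (memLp_and_integral_sq_of_map_eq_gaussianReal hv).2
  have hw2 := (memLp_and_integral_sq_of_map_eq_gaussianReal hw).2
  rw [hsq] at hv2 hw2
  have hvw : v = w := by
    rw [← NNReal.coe_inj, ← hv2, ← hw2]
    field_simp
    ring
  rw [hv, hw, hvw]

/-- **Symmetry of one-dimensional perturbations in distribution** (Nazarov): for a
centered Gaussian random function `X` with `ψ = 𝒢_X φ`,
`q = ∬ G(x,y) φ(x) φ(y) dx dy ∈ (0,∞)` and
`X_{φ,α}(x) = X(x) - α ψ(x) ∫_𝒪 X(u) φ(u) du`, one has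
`X_{φ,α} ≐ X_{φ, 2/q - α}` (equality of all finite-dimensional distributions). -/
theorem one_dimensional_perturbation_distributional_symmetry
    {Ω : Type*} [MeasurableSpace Ω] (P : Measure Ω) [IsProbabilityMeasure P]
    {d : ℕ} (O : Set (EuclideanSpace ℝ (Fin d))) (hO : IsBounded O)
    (hOmeas : MeasurableSet O)
    (X : EuclideanSpace ℝ (Fin d) → Ω → ℝ)
    (G : EuclideanSpace ℝ (Fin d) → EuclideanSpace ℝ (Fin d) → ℝ)
    (φ ψ : EuclideanSpace ℝ (Fin d) → ℝ) (q α : ℝ)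
    (hXmeas : Measurable (Function.uncurry X))
    (hGauss : ∀ (n : ℕ) (x : Fin n → EuclideanSpace ℝ (Fin d)) (c : Fin n → ℝ) (c₀ : ℝ),
      ∃ v : NNReal, Measure.map
        (fun ω => (∑ i, c i * X (x i) ω) + c₀ * ∫ u in O, X u ω * φ u) P
        = gaussianReal 0 v)
    (hcov : ∀ x y, ∫ ω, X x ω * X y ω ∂P = G x y)
    (hcovint : ∀ x y, Integrable (fun ω => X x ω * X y ω) P)
    (hψ : ∀ x, ψ x = ∫ u in O, G x u * φ u)
    (hq : q = ∫ x in O, ∫ y in O, G x y * φ x * φ y)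
    (hqpos : 0 < q)
    (hpath : ∀ ω, IntegrableOn (fun u => X u ω * φ u) O)
    (h1 : ∀ x, Integrable (fun p : Ω × EuclideanSpace ℝ (Fin d) =>
      X x p.1 * (X p.2 p.1 * φ p.2)) (P.prod (volume.restrict O)))
    (h2 : Integrable (fun p : Ω × (EuclideanSpace ℝ (Fin d) × EuclideanSpace ℝ (Fin d)) =>
      (X p.2.1 p.1 * φ p.2.1) * (X p.2.2 p.1 * φ p.2.2))
      (P.prod ((volume.restrict O).prod (volume.restrict O)))) :
    ∀ (n : ℕ) (x : Fin n → EuclideanSpace ℝ (Fin d)),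
      Measure.map (fun ω => fun i : Fin n =>
          X (x i) ω - α * ψ (x i) * ∫ u in O, X u ω * φ u) P
        = Measure.map (fun ω => fun i : Fin n =>
            X (x i) ω - (2/q - α) * ψ (x i) * ∫ u in O, X u ω * φ u) P := by
  intro n x
  have hψx (y : EuclideanSpace ℝ (Fin d)) :
      ∫ ω, X y ω * (∫ u in O, X u ω * φ u) ∂P = ψ y := by
    simp only [hψ, ← integral_const_mul]
    rw [integral_integral_swap (h1 y)]
    simp only [← mul_assoc, integral_mul_const, hcov]
  have hI2 : ∫ ω, (∫ u in O, X u ω * φ u) ^ 2 ∂P = q := by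
    have hker (p : EuclideanSpace ℝ (Fin d) × EuclideanSpace ℝ (Fin d)) :
        ∫ ω, (X p.1 ω * φ p.1) * (X p.2 ω * φ p.2) ∂P = G p.1 p.2 * φ p.1 * φ p.2 := by
      simp only [← hcov, ← integral_mul_const]
      congr with ω
      ring
    have hint := h2.integral_prod_right
    simp only [hker] at hint
    simp only [sq, ← integral_prod_mul]
    rw [integral_integral_swap h2]
    simp only [hker]
    rw [integral_prod _ hint, hq]
  exact map_sub_mul_eq_of_gaussian (hGauss n x) (fun i => hψx (x i)) hI2 hqpos.ne' α
end
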